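/- arXiv:2101.07730 — 4 statements merged into one kernel-verified Lean document; each statement's English description precedes it below -/
import Mathlib

section
/- Let W be an n×n real matrix, c ≥ 1, and a a real scalar such that I_n − a·W is invertible. Then I_{nc} − a·(W ⊗ I_c) is invertible and (I_{nc} − a·(W ⊗ I_c))⁻¹ = (I_n − a·W)⁻¹ ⊗ I_c. Consequently, the LinBP stationary solution p̂ = (I_{nc} − a·(W ⊗ I_c))⁻¹ φ̂ propagates each label class independently: for every class k ∈ Fin c, the vector of k-th components (p̂_u(k))_{u} ∈ ℝ^n equals (I_n − a·W)⁻¹ applied to the vector of k-th components (φ̂_u(k))_u. -/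
open Matrix Kronecker

theorem Matrix.one_sub_smul_kronecker_one {m n R : Type*} [DecidableEq m] [DecidableEq n]
    [CommRing R] (W : Matrix m m R) (a : R) :
    (1 : Matrix (m × n) (m × n) R) - a • (W ⊗ₖ (1 : Matrix n n R)) =
      (1 - a • W) ⊗ₖ (1 : Matrix n n R) := by
  rw [← one_kronecker_one, ← smul_kronecker]
  ext i j
  simp only [sub_apply, kroneckerMap_apply, sub_mul]

theorem Matrix.kronecker_one_mulVec_apply {l m n R : Type*} [Fintype m] [Fintype n]
    [DecidableEq n] [CommSemiring R] (A : Matrix l m R) (v : m × n → R) (i : l) (k : n) :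
    ((A ⊗ₖ (1 : Matrix n n R)) *ᵥ v) (i, k) = (A *ᵥ fun j => v (j, k)) i := by
  simp [mulVec, dotProduct, Fintype.sum_prod_type, kroneckerMap_apply, one_apply]

theorem Matrix.isUnit_kronecker {m n R : Type*} [Fintype m] [Fintype n] [DecidableEq m]
    [DecidableEq n] [CommRing R] {A : Matrix m m R} {B : Matrix n n R}
    (hA : IsUnit A) (hB : IsUnit B) : IsUnit (A ⊗ₖ B) := by
  rw [isUnit_iff_isUnit_det] at *
  rw [det_kronecker]
  exact (hA.pow _).mul (hB.pow _)

/-- If `I_n - a•W` is invertible, then `I_{nc} - a•(W ⊗ I_c)` is invertible with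
inverse `(I_n - a•W)⁻¹ ⊗ I_c`, and the LinBP stationary solution propagates each label class
independently: for every class `k`, the vector of `k`-th components of `p̂` equals
`(I_n - a•W)⁻¹` applied to the vector of `k`-th components of `φ̂`. -/
theorem linbp_kronecker_per_class
    {n c : ℕ} (hc : 1 ≤ c) (W : Matrix (Fin n) (Fin n) ℝ) (a : ℝ)
    (hinv : IsUnit ((1 : Matrix (Fin n) (Fin n) ℝ) - a • W)) :
    IsUnit ((1 : Matrix (Fin n × Fin c) (Fin n × Fin c) ℝ)
        - a • (W ⊗ₖ (1 : Matrix (Fin c) (Fin c) ℝ))) ∧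
    ((1 : Matrix (Fin n × Fin c) (Fin n × Fin c) ℝ)
        - a • (W ⊗ₖ (1 : Matrix (Fin c) (Fin c) ℝ)))⁻¹ =
      ((1 : Matrix (Fin n) (Fin n) ℝ) - a • W)⁻¹ ⊗ₖ (1 : Matrix (Fin c) (Fin c) ℝ) ∧
    ∀ φ p : Fin n × Fin c → ℝ,
      p = ((1 : Matrix (Fin n × Fin c) (Fin n × Fin c) ℝ)
          - a • (W ⊗ₖ (1 : Matrix (Fin c) (Fin c) ℝ)))⁻¹.mulVec φ →
      ∀ k : Fin c,
        (fun u : Fin n => p (u, k)) =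
          ((1 : Matrix (Fin n) (Fin n) ℝ) - a • W)⁻¹.mulVec (fun u : Fin n => φ (u, k)) := by
  rw [one_sub_smul_kronecker_one, inv_kronecker, inv_one]
  refine ⟨isUnit_kronecker hinv isUnit_one, rfl, ?_⟩
  rintro φ p rfl k
  funext u
  exact kronecker_one_mulVec_apply _ φ u k
end

section
/- Let c ≥ 1, let ε be a real number with ε² ≠ c², and set Φ̂ = ε·I_c. If m̂_uv, m̂_vu ∈ ℝ^c satisfy m̂_uv = Φ̂ p̂_u − (1/c) Φ̂ m̂_vu and m̂_vu = Φ̂ p̂_v − (1/c) Φ̂ m̂_uv for given p̂_u, p̂_v ∈ ℝ^c, then m̂_uv = (1 − ε²/c²)⁻¹ · (ε p̂_u − (ε²/c) p̂_v). -/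
open Matrix

/-- In the homophily specialization `Φ̂ = ε • I_c` with `ε² ≠ c²`, the
converged residual message equations `m̂_uv = Φ̂ p̂_u - (1/c) Φ̂ m̂_vu` and
`m̂_vu = Φ̂ p̂_v - (1/c) Φ̂ m̂_uv` imply
`m̂_uv = (1 - ε²/c²)⁻¹ • (ε • p̂_u - (ε²/c) • p̂_v)`. -/
theorem linbp_message_closed_form_homophily
    {c : ℕ} (hc : 1 ≤ c) (ε : ℝ) (hε : ε ^ 2 ≠ (c : ℝ) ^ 2)
    (pu pv muv mvu : Fin c → ℝ)
    (h1 : muv = (ε • (1 : Matrix (Fin c) (Fin c) ℝ)).mulVec pu -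
      (1 / (c : ℝ)) • (ε • (1 : Matrix (Fin c) (Fin c) ℝ)).mulVec mvu)
    (h2 : mvu = (ε • (1 : Matrix (Fin c) (Fin c) ℝ)).mulVec pv -
      (1 / (c : ℝ)) • (ε • (1 : Matrix (Fin c) (Fin c) ℝ)).mulVec muv) :
    muv = (1 - ε ^ 2 / (c : ℝ) ^ 2)⁻¹ • (ε • pu - (ε ^ 2 / (c : ℝ)) • pv) := by
  have hc0 : (c : ℝ) ≠ 0 := by positivity
  have hdet : 1 - ε ^ 2 / (c : ℝ) ^ 2 ≠ 0 := by
    rw [sub_ne_zero, ne_comm, Ne, div_eq_one_iff_eq (pow_ne_zero 2 hc0)]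
    exact hε
  simp only [smul_mulVec, one_mulVec] at h1 h2
  rw [eq_inv_smul_iff₀ hdet]
  ext i
  have hu := congrFun h1 i
  have hv := congrFun h2 i
  simp only [Pi.sub_apply, Pi.smul_apply, smul_eq_mul] at hu hv ⊢
  linear_combination hu - ε / c * hv
end

section
/- Let W be an n×n real matrix, c ≥ 1, a a real scalar, and let d_max = max_u Σ_v |W_{uv}|. If |a| · d_max < 1, then I_n − a·W is invertible, I_{nc} − a·(W ⊗ I_c) is invertible, and the LinBP iteration p̂_u^{(t+1)} = φ̂_u + a · Σ_v W_{uv} p̂_v^{(t)} converges, for any initial condition, to the unique fixed point (I_{nc} − a·(W ⊗ I_c))⁻¹ φ̂. -/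
open Matrix Kronecker Filter Finset

section RowSum

variable {ι : Type*} [Fintype ι] [DecidableEq ι]

attribute [local instance] Matrix.linftyOpNormedRing Matrix.linftyOpNormedAlgebra

theorem Matrix.linfty_opNorm_lt_one {A : Matrix ι ι ℝ} (hA : ∀ i, ∑ j, |A i j| < 1) :
    ‖A‖ < 1 := by
  rw [Matrix.linfty_opNorm_def, ← NNReal.coe_one, NNReal.coe_lt_coe,
    Finset.sup_lt_iff (by simp)]
  intro i _
  rw [← NNReal.coe_lt_coe]
  simpa using hA i

theorem Matrix.isUnit_one_sub_of_row_sum_lt_one {A : Matrix ι ι ℝ}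
    (hA : ∀ i, ∑ j, |A i j| < 1) : IsUnit (1 - A) :=
  isUnit_one_sub_of_norm_lt_one (Matrix.linfty_opNorm_lt_one hA)

theorem Matrix.eq_inv_one_sub_mulVec_iff {A : Matrix ι ι ℝ} (hA : IsUnit (1 - A))
    {b x : ι → ℝ} : x = (1 - A)⁻¹ *ᵥ b ↔ x = b + A *ᵥ x := by
  have hdet := (Matrix.isUnit_iff_isUnit_det _).mp hA
  have key : x = b + A *ᵥ x ↔ (1 - A) *ᵥ x = b := by
    rw [Matrix.sub_mulVec, Matrix.one_mulVec, sub_eq_iff_eq_add]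
  rw [key]
  constructor
  · rintro rfl
    rw [Matrix.mulVec_mulVec, Matrix.mul_nonsing_inv _ hdet, Matrix.one_mulVec]
  · rintro rfl
    rw [Matrix.mulVec_mulVec, Matrix.nonsing_inv_mul _ hdet, Matrix.one_mulVec]

theorem Matrix.tendsto_affine_iterate_of_row_sum_lt_one {A : Matrix ι ι ℝ}
    (hA : ∀ i, ∑ j, |A i j| < 1) {b : ι → ℝ} {x : ℕ → ι → ℝ}
    (hx : ∀ t, x (t + 1) = b + A *ᵥ x t) :
    Tendsto x atTop (nhds ((1 - A)⁻¹ *ᵥ b)) := by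
  set y := (1 - A)⁻¹ *ᵥ b with hy
  have hfix : y = b + A *ᵥ y :=
    (Matrix.eq_inv_one_sub_mulVec_iff (Matrix.isUnit_one_sub_of_row_sum_lt_one hA)).mp hy
  have hbound : ∀ t, ‖x t - y‖ ≤ ‖A‖ ^ t * ‖x 0 - y‖ := by
    intro t
    induction t with
    | zero => simp
    | succ t ih =>
      have hstep : x (t + 1) - y = A *ᵥ (x t - y) := by
        rw [Matrix.mulVec_sub, hx t]
        nth_rewrite 1 [hfix]
        abel
      calc ‖x (t + 1) - y‖ ≤ ‖A‖ * ‖x t - y‖ := by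
            rw [hstep]; exact Matrix.linfty_opNorm_mulVec _ _
        _ ≤ ‖A‖ * (‖A‖ ^ t * ‖x 0 - y‖) := by gcongr
        _ = ‖A‖ ^ (t + 1) * ‖x 0 - y‖ := by ring
  rw [tendsto_iff_norm_sub_tendsto_zero]
  refine squeeze_zero (fun _ => norm_nonneg _) hbound ?_
  simpa using (tendsto_pow_atTop_nhds_zero_of_lt_one (norm_nonneg A)
    (Matrix.linfty_opNorm_lt_one hA)).mul_const ‖x 0 - y‖

end RowSum

theorem Matrix.kronecker_one_mulVec_apply_s12 {m k : Type*} [Fintype m] [Fintype k] [DecidableEq k]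
    (W : Matrix m m ℝ) (q : m → k → ℝ) (x : m × k) :
    ((W ⊗ₖ (1 : Matrix k k ℝ)) *ᵥ fun y => q y.1 y.2) x = ∑ v, W x.1 v * q v x.2 := by
  simp [Matrix.mulVec, dotProduct, Fintype.sum_prod_type, Matrix.one_apply]

theorem Matrix.row_sum_abs_kronecker_one {m k : Type*} [Fintype m] [Fintype k] [DecidableEq k]
    (W : Matrix m m ℝ) (x : m × k) :
    ∑ y, |(W ⊗ₖ (1 : Matrix k k ℝ)) x y| = ∑ v, |W x.1 v| := by
  simp [Fintype.sum_prod_type, Matrix.one_apply, apply_ite abs]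

/-- Let `d_max = max_u Σ_v |W_{uv}|`. If `|a| · d_max < 1` then `I_n - a•W`
and `I_{nc} - a•(W ⊗ I_c)` are invertible, and the LinBP iteration
`p̂_u^{(t+1)} = φ̂_u + a • Σ_v W_{uv} • p̂_v^{(t)}` converges, from any initial condition,
to the unique fixed point `(I_{nc} - a•(W ⊗ I_c))⁻¹ φ̂`. -/
theorem linbp_converges_of_degree_bound
    {n c : ℕ} (hn : 0 < n) (hc : 1 ≤ c)
    (W : Matrix (Fin n) (Fin n) ℝ) (a : ℝ)
    (ha : |a| * (Finset.univ.sup' (@Finset.univ_nonempty (Fin n) _ ⟨⟨0, hn⟩⟩)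
        fun u => ∑ v, |W u v|) < 1) :
    IsUnit ((1 : Matrix (Fin n) (Fin n) ℝ) - a • W) ∧
    IsUnit ((1 : Matrix (Fin n × Fin c) (Fin n × Fin c) ℝ)
        - a • (W ⊗ₖ (1 : Matrix (Fin c) (Fin c) ℝ))) ∧
    ∀ (φ : Fin n → Fin c → ℝ) (p : ℕ → Fin n → Fin c → ℝ),
      (∀ t u, p (t + 1) u = φ u + a • ∑ v, W u v • p t v) →
      (Tendsto (fun t : ℕ => fun x : Fin n × Fin c => p t x.1 x.2) atTop
        (nhds (((1 : Matrix (Fin n × Fin c) (Fin n × Fin c) ℝ)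
            - a • (W ⊗ₖ (1 : Matrix (Fin c) (Fin c) ℝ)))⁻¹.mulVec
          (fun x : Fin n × Fin c => φ x.1 x.2))) ∧
      ∀ pfix : Fin n → Fin c → ℝ,
        (∀ u, pfix u = φ u + a • ∑ v, W u v • pfix v) →
        (fun x : Fin n × Fin c => pfix x.1 x.2) =
          ((1 : Matrix (Fin n × Fin c) (Fin n × Fin c) ℝ)
              - a • (W ⊗ₖ (1 : Matrix (Fin c) (Fin c) ℝ)))⁻¹.mulVec
            (fun x : Fin n × Fin c => φ x.1 x.2)) := by
  have hrow : ∀ u, |a| * ∑ v, |W u v| < 1 := fun u =>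
    lt_of_le_of_lt (mul_le_mul_of_nonneg_left
      (Finset.le_sup' (fun u => ∑ v, |W u v|) (Finset.mem_univ u)) (abs_nonneg a)) ha
  have hW : ∀ u, ∑ v, |(a • W) u v| < 1 := fun u => by
    simpa [abs_mul, ← Finset.mul_sum] using hrow u
  have hK : ∀ x, ∑ y, |(a • (W ⊗ₖ (1 : Matrix (Fin c) (Fin c) ℝ))) x y| < 1 := fun x => by
    simp only [Matrix.smul_apply, smul_eq_mul, abs_mul a, ← Finset.mul_sum,
      Matrix.row_sum_abs_kronecker_one]
    exact hrow x.1
  have hKunit := Matrix.isUnit_one_sub_of_row_sum_lt_one hK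
  have hstack : ∀ φ q r : Fin n → Fin c → ℝ, (∀ u, r u = φ u + a • ∑ v, W u v • q v) →
      (fun x : Fin n × Fin c => r x.1 x.2) = (fun x : Fin n × Fin c => φ x.1 x.2) +
        (a • (W ⊗ₖ (1 : Matrix (Fin c) (Fin c) ℝ))) *ᵥ fun x => q x.1 x.2 := by
    intro φ q r h
    funext x
    rw [Pi.add_apply, Matrix.smul_mulVec, Pi.smul_apply, Matrix.kronecker_one_mulVec_apply_s12, h x.1]
    simp
  exact ⟨Matrix.isUnit_one_sub_of_row_sum_lt_one hW, hKunit, fun φ p hp =>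
    ⟨Matrix.tendsto_affine_iterate_of_row_sum_lt_one hK fun t => hstack φ _ _ (hp t),
      fun pfix hfix => (Matrix.eq_inv_one_sub_mulVec_iff hKunit).mpr (hstack φ _ _ hfix)⟩⟩
end

section
/- Let W be an n×n real symmetric matrix partitioned by index sets U and L (with V = U ⊔ L), let a be a real scalar such that (I − a·W)_{UU} is invertible, and let P̂_L ∈ ℝ^{|L| × c} be the matrix whose row for v ∈ L is the residual one-hot vector p̂_v = e_{ȳ_v} − (1/c)𝟙_c of an observed label ȳ_v ∈ Fin c. Define residual priors on U by φ̂_u = a · Σ_{v ∈ N(u) ∩ L} p̂_v, i.e., the matrix Φ̂_U = a · W_{UL} P̂_L. Then the unique solution P̂_U ∈ ℝ^{|U| × c} of the per-class LinBP fixed-point equations P̂_U = Φ̂_U + a · W_{UU} P̂_U is P̂_U = (I − a·W)_{UU}⁻¹ (a · W_{UL} P̂_L), i.e., LinBP with these residual priors reproduces the label-propagation closed-form solution applied per class. -/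
open Matrix Finset

/-- A left linear system with an invertible coefficient matrix has the inverse solution. -/
theorem Matrix.eq_inv_mul_iff_mul_eq_of_isUnit {m n R : Type*} [Fintype m] [DecidableEq m]
    [CommRing R] {A : Matrix m m R} (hA : IsUnit A) (X B : Matrix m n R) :
    X = A⁻¹ * B ↔ A * X = B := by
  have hdet : IsUnit A.det := (Matrix.isUnit_iff_isUnit_det A).mp hA
  constructor
  · rintro rfl
    exact Matrix.mul_nonsing_inv_cancel_left A B hdet
  · rintro rfl
    exact (Matrix.nonsing_inv_mul_cancel_left A X hdet).symm

/-- A diagonal block of `1 - a • W` is `1` minus `a` times the corresponding block of `W`. -/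
theorem Matrix.submatrix_one_sub_smul {m n R : Type*} [DecidableEq m] [DecidableEq n]
    [CommRing R] (W : Matrix n n R) (a : R) {f : m → n} (hf : Function.Injective f) :
    (1 - a • W).submatrix f f = 1 - a • W.submatrix f f := by
  rw [Matrix.submatrix_sub, Pi.sub_apply, Pi.sub_apply, Matrix.submatrix_one f hf,
    Matrix.submatrix_smul, Pi.smul_apply, Pi.smul_apply]

/-- For a symmetric matrix `W` on the index set `V = U ⊕ L` (unlabeled `U`,
labeled `L`) such that `(I - a•W)_{UU}` is invertible, let `P̂_L` have rows
`p̂_v = e_{ȳ_v} - (1/c)𝟙_c` for the observed labels `ȳ_v`, and set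
`Φ̂_U = a • W_{UL} P̂_L`. Then the unique solution of the per-class LinBP fixed-point
equations `P̂_U = Φ̂_U + a • W_{UU} P̂_U` is
`P̂_U = (I - a•W)_{UU}⁻¹ (a • W_{UL} P̂_L)`, reproducing the label-propagation
closed-form solution per class. -/
theorem linbp_reproduces_label_propagation
    {nU nL c : ℕ} (hc : 1 ≤ c)
    (W : Matrix (Fin nU ⊕ Fin nL) (Fin nU ⊕ Fin nL) ℝ)
    (hW : W.IsSymm)
    (a : ℝ)
    (hinv : IsUnit (((1 : Matrix (Fin nU ⊕ Fin nL) (Fin nU ⊕ Fin nL) ℝ) - a • W).submatrix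
        Sum.inl Sum.inl))
    (ybar : Fin nL → Fin c)
    (PL : Matrix (Fin nL) (Fin c) ℝ)
    (hPL : ∀ v k, PL v k = (if k = ybar v then (1 : ℝ) else 0) - 1 / c) :
    ∀ PU : Matrix (Fin nU) (Fin c) ℝ,
      (PU = a • (W.submatrix Sum.inl Sum.inr * PL)
          + a • (W.submatrix Sum.inl Sum.inl * PU)) ↔
      PU = (((1 : Matrix (Fin nU ⊕ Fin nL) (Fin nU ⊕ Fin nL) ℝ) - a • W).submatrix
          Sum.inl Sum.inl)⁻¹ * (a • (W.submatrix Sum.inl Sum.inr * PL)) := by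
  intro PU
  rw [Matrix.eq_inv_mul_iff_mul_eq_of_isUnit hinv,
    Matrix.submatrix_one_sub_smul W a Sum.inl_injective, Matrix.sub_mul, Matrix.one_mul,
    Matrix.smul_mul, sub_eq_iff_eq_add]
end
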